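/- arXiv:2109.15061 — 6 statements merged into one kernel-verified Lean document; each statement's English description precedes it below -/
import Mathlib

section
/- Let X be a bounded metric space, let φ : X → ℝ be an L-Lipschitz function, let q ∈ [1,∞], and let α, β be Radon probability measures on X. Then |(∫_X |φ(x)|^q α(dx))^{1/q} − (∫_X |φ(x)|^q β(dx))^{1/q}| ≤ L · d_{W,q}(α,β), where for q = ∞ the q-th root of the integral is interpreted as the supremum of |φ| over the support of the measure. -/
open MeasureTheory ENNReal NNReal

noncomputable section

namespace Paper

variable {X Y : Type*}

/-- The (topological) support of a measure: points all of whose open neighborhoods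
have positive measure. -/
def msupport [TopologicalSpace X] [MeasurableSpace X] (α : Measure X) : Set X :=
  {x | ∀ U : Set X, IsOpen U → x ∈ U → 0 < α U}

/-- The `p`-diameter of a measure, `p ∈ [1,∞]`.  For `p = ∞` it is the diameter of the
support; for finite `p` it is `(∬ d(x,x')^p dα dα)^{1/p}`. -/
def pDiam [PseudoEMetricSpace X] [MeasurableSpace X] (p : ℝ≥0∞) (α : Measure X) : ℝ≥0∞ :=
  if p = ∞ then EMetric.diam (msupport α)
  else (∫⁻ x, ∫⁻ y, edist x y ^ p.toReal ∂α ∂α) ^ (1 / p.toReal)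

/-- The `p`-radius of a measure, `p ∈ [1,∞]`.  For `p = ∞` it is the radius of the
support; for finite `p` it is `inf_x (∫ d(x,x')^p dα)^{1/p}`. -/
def pRad [PseudoEMetricSpace X] [MeasurableSpace X] (p : ℝ≥0∞) (α : Measure X) : ℝ≥0∞ :=
  if p = ∞ then ⨅ x : X, ⨆ a ∈ msupport α, edist x a
  else ⨅ x : X, (∫⁻ y, edist x y ^ p.toReal ∂α) ^ (1 / p.toReal)

/-- Couplings between two measures: measures on the product with the given marginals. -/
def Coupling [MeasurableSpace X] (α β : Measure X) : Set (Measure (X × X)) :=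
  {μ | μ.map Prod.fst = α ∧ μ.map Prod.snd = β}

/-- The `q`-Wasserstein distance, `q ∈ [1,∞]`. -/
def wDist [PseudoEMetricSpace X] [MeasurableSpace X] (q : ℝ≥0∞) (α β : Measure X) : ℝ≥0∞ :=
  if q = ∞ then ⨅ μ ∈ Coupling α β, ⨆ z ∈ msupport μ, edist z.1 z.2
  else ⨅ μ ∈ Coupling α β, (∫⁻ z, edist z.1 z.2 ^ q.toReal ∂μ) ^ (1 / q.toReal)

/-- The distortion `sup |d(x,x') - d(f x, f x')|` of a map between (pseudo e)metric spaces. -/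
def distortion [PseudoEMetricSpace X] [PseudoEMetricSpace Y] (f : X → Y) : ℝ≥0∞ :=
  ⨆ x : X, ⨆ x' : X,
    max (edist x x' - edist (f x) (f x')) (edist (f x) (f x') - edist x x')

/-- The codistortion `sup_{x,y} |d_X(x, ψ y) - d_Y(φ x, y)|` of a pair of maps. -/
def codistortion [PseudoEMetricSpace X] [PseudoEMetricSpace Y] (φ : X → Y) (ψ : Y → X) :
    ℝ≥0∞ :=
  ⨆ x : X, ⨆ y : Y,
    max (edist x (ψ y) - edist (φ x) y) (edist (φ x) y - edist x (ψ y))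

/-- Gromov--Hausdorff distance, via the distortion/codistortion formula. -/
def ghDist (X Y : Type*) [PseudoEMetricSpace X] [PseudoEMetricSpace Y] : ℝ≥0∞ :=
  (1 / 2 : ℝ≥0∞) *
    ⨅ φ : X → Y, ⨅ ψ : Y → X,
      max (distortion φ) (max (distortion ψ) (codistortion φ ψ))

/-- The invariant `i_{q,p}(α) = (∫ d_{W,q}(α, δ_x)^p dα(x))^{1/p}`. -/
def iInv [PseudoEMetricSpace X] [MeasurableSpace X] (q p : ℝ≥0∞) (α : Measure X) : ℝ≥0∞ :=
  if p = ∞ then ⨆ x ∈ msupport α, wDist q α (Measure.dirac x)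
  else (∫⁻ x, wDist q α (Measure.dirac x) ^ p.toReal ∂α) ^ (1 / p.toReal)

/-- Dirac delta as a probability measure. -/
def diracPM [MeasurableSpace X] (x : X) : ProbabilityMeasure X :=
  ⟨Measure.dirac x, inferInstance⟩

/-- Finitely supported probability measures. -/
def finPM (X : Type*) [TopologicalSpace X] [MeasurableSpace X] : Set (ProbabilityMeasure X) :=
  {α | (msupport α.toMeasure).Finite}

/-- The `p`-Vietoris--Rips metric thickening at scale `r`, as a subset of the space of
probability measures with the weak topology. -/
def VRm (p : ℝ≥0∞) (X : Type*) [PseudoEMetricSpace X] [MeasurableSpace X] (r : ℝ≥0∞) :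
    Set (ProbabilityMeasure X) :=
  {α | pDiam p α.toMeasure < r}

/-- The `p`-Čech metric thickening at scale `r`. -/
def Cechm (p : ℝ≥0∞) (X : Type*) [PseudoEMetricSpace X] [MeasurableSpace X] (r : ℝ≥0∞) :
    Set (ProbabilityMeasure X) :=
  {α | pRad p α.toMeasure < r}

/-- Finitely supported version of the `p`-Vietoris--Rips thickening. -/
def VRmFin (p : ℝ≥0∞) (X : Type*) [PseudoEMetricSpace X] [MeasurableSpace X] (r : ℝ≥0∞) :
    Set (ProbabilityMeasure X) :=
  VRm p X r ∩ finPM X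

/-- Finitely supported version of the `p`-Čech thickening. -/
def CechmFin (p : ℝ≥0∞) (X : Type*) [PseudoEMetricSpace X] [MeasurableSpace X] (r : ℝ≥0∞) :
    Set (ProbabilityMeasure X) :=
  Cechm p X r ∩ finPM X


/-- Convex combination `(1-t)·α + t·β` of probability measures. -/
def lincomb [MeasurableSpace X] (t : ℝ) (h0 : 0 ≤ t) (h1 : t ≤ 1)
    (α β : ProbabilityMeasure X) : ProbabilityMeasure X :=
  ⟨ENNReal.ofReal (1 - t) • α.toMeasure + ENNReal.ofReal t • β.toMeasure, by
    constructor
    simp only [Measure.coe_add, Pi.add_apply, Measure.smul_apply, smul_eq_mul,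
      measure_univ, mul_one]
    rw [← ENNReal.ofReal_add (by linarith) h0]
    norm_num⟩

/-- A `δ`-map between spaces-with-functions. -/
def IsDeltaMap {A B : Type*} [TopologicalSpace A] [TopologicalSpace B]
    (φA : A → ℝ) (φB : B → ℝ) (δ : ℝ) (F : A → B) : Prop :=
  Continuous F ∧ ∀ a, φB (F a) ≤ φA a + δ

/-- `δ`-homotopy between two `δ`-maps. -/
def DeltaHomotopic {A B : Type*} [TopologicalSpace A] [TopologicalSpace B]
    (φA : A → ℝ) (φB : B → ℝ) (δ : ℝ) (F₀ F₁ : A → B) : Prop :=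
  ∃ H : A × unitInterval → B, Continuous H ∧
    (∀ a, H (a, 0) = F₀ a) ∧ (∀ a, H (a, 1) = F₁ a) ∧
    ∀ t : unitInterval, IsDeltaMap φA φB δ (fun a => H (a, t))

/-- `δ`-homotopy equivalence between two spaces-with-functions. -/
def DeltaHomotopyEquiv {A B : Type*} [TopologicalSpace A] [TopologicalSpace B]
    (δ : ℝ) (φA : A → ℝ) (φB : B → ℝ) : Prop :=
  ∃ F : A → B, ∃ G : B → A,
    IsDeltaMap φA φB δ F ∧ IsDeltaMap φB φA δ G ∧
    DeltaHomotopic φA φA (2 * δ) (G ∘ F) id ∧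
    DeltaHomotopic φB φB (2 * δ) (F ∘ G) id

/-- The homotopy type distance `d_HT`. -/
def dHT {A B : Type*} [TopologicalSpace A] [TopologicalSpace B]
    (φA : A → ℝ) (φB : B → ℝ) : ℝ≥0∞ :=
  sInf {e : ℝ≥0∞ | ∃ δ : ℝ, 0 ≤ δ ∧ DeltaHomotopyEquiv δ φA φB ∧ e = ENNReal.ofReal δ}

/-- The `p`-spread of a metric space. -/
def pSpread (p : ℝ≥0∞) (X : Type*) [PseudoEMetricSpace X] [MeasurableSpace X] : ℝ≥0∞ :=
  ⨅ αs ∈ finPM X, ⨆ α : ProbabilityMeasure X,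
    wDist p (αs : ProbabilityMeasure X).toMeasure α.toMeasure

/-- The medial axis of a subset `X` of a normed space. -/
def medialAxis {E : Type*} [NormedAddCommGroup E] (X : Set E) : Set E :=
  closure {y | ∃ x₁ ∈ X, ∃ x₂ ∈ X, x₁ ≠ x₂ ∧
    dist y x₁ = Metric.infDist y X ∧ dist y x₂ = Metric.infDist y X}

/-- The reach of a subset `X`: the distance from `X` to its medial axis. -/
def reach {E : Type*} [NormedAddCommGroup E] (X : Set E) : ℝ≥0∞ :=
  ⨅ x ∈ X, ⨅ y ∈ medialAxis X, edist x y

/-- `p`-radius with the infimum restricted to a subset `X` of the ambient space. -/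
def pRadIn {E : Type*} [PseudoEMetricSpace E] [MeasurableSpace E] (p : ℝ≥0∞)
    (X : Set E) (α : Measure E) : ℝ≥0∞ :=
  ⨅ x ∈ X, (∫⁻ y, edist x y ^ p.toReal ∂α) ^ (1 / p.toReal)


/-- The `q`-integral norm `(∫ |φ|^q dα)^{1/q}` of a function against a measure, with the
`q = ∞` case interpreted as the supremum of `|φ|` over the support of the measure. -/
def pNormMeas {X : Type*} [TopologicalSpace X] [MeasurableSpace X]
    (q : ℝ≥0∞) (φ : X → ℝ) (α : Measure X) : ℝ≥0∞ :=
  if q = ∞ then ⨆ x ∈ msupport α, ENNReal.ofReal |φ x|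
  else (∫⁻ x, ENNReal.ofReal |φ x| ^ q.toReal ∂α) ^ (1 / q.toReal)

theorem exists_mem_msupport_of_isCompact [TopologicalSpace X] [MeasurableSpace X]
    {μ : Measure X} {K : Set X} (hK : IsCompact K) (hμ : μ K ≠ 0) :
    ∃ x ∈ K, x ∈ msupport μ := by
  by_contra! h
  refine hμ (hK.induction_on (p := fun s => μ s = 0) measure_empty
    (fun _ _ hst ht => measure_mono_null hst ht)
    (fun _ _ hs ht => measure_union_null hs ht) fun x hx => ?_)
  have hx' := h x hx
  simp only [msupport, Set.mem_ofPred_eq, not_forall, not_lt, nonpos_iff_eq_zero] at hx'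
  obtain ⟨U, hU, hxU, hU0⟩ := hx'
  exact ⟨U, mem_nhdsWithin_of_mem_nhds (hU.mem_nhds hxU), hU0⟩

theorem map_mem_msupport [TopologicalSpace X] [MeasurableSpace X] [TopologicalSpace Y]
    [MeasurableSpace Y] {μ : Measure X} {f : X → Y} (hf : Continuous f)
    (hfm : AEMeasurable f μ) {x : X} (hx : x ∈ msupport μ) : f x ∈ msupport (μ.map f) :=
  fun U hU hxU =>
    (hx (f ⁻¹' U) (hU.preimage hf) hxU).trans_le (Measure.le_map_apply hfm U)

theorem map_swap_mem_Coupling [MeasurableSpace X] {α β : Measure X} {μ : Measure (X × X)}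
    (hμ : μ ∈ Coupling α β) : μ.map Prod.swap ∈ Coupling β α := by
  refine ⟨?_, ?_⟩
  · rw [Measure.map_map measurable_fst measurable_swap]; exact hμ.2
  · rw [Measure.map_map measurable_snd measurable_swap]; exact hμ.1

theorem prod_mem_Coupling [MeasurableSpace X] (α β : Measure X) [IsProbabilityMeasure α]
    [IsProbabilityMeasure β] : α.prod β ∈ Coupling α β := by
  simp [Coupling]

theorem wDist_swap_le [PseudoEMetricSpace X] [MeasurableSpace X] (q : ℝ≥0∞)
    (α β : Measure X) : wDist q β α ≤ wDist q α β := by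
  unfold wDist
  split_ifs with hq
  · refine le_iInf₂ fun μ hμ => iInf₂_le_of_le _ (map_swap_mem_Coupling hμ) ?_
    refine iSup₂_le fun z hz => ?_
    have hz' := map_mem_msupport continuous_swap measurable_swap.aemeasurable hz
    rw [Measure.map_map measurable_swap measurable_swap, Prod.swap_swap_eq, Measure.map_id] at hz'
    rw [edist_comm]
    exact le_iSup₂_of_le z.swap hz' le_rfl
  · refine le_iInf₂ fun μ hμ => iInf₂_le_of_le _ (map_swap_mem_Coupling hμ) (le_of_eq ?_)
    have h := lintegral_map_equiv (μ := μ) (fun z : X × X => edist z.1 z.2 ^ q.toReal)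
      MeasurableEquiv.prodComm
    simp only [MeasurableEquiv.prodComm, MeasurableEquiv.coe_mk, Equiv.coe_prodComm,
      Prod.fst_swap, Prod.snd_swap] at h
    rw [h]
    simp_rw [edist_comm]

theorem exists_mem_msupport_coupling [TopologicalSpace X] [T2Space X] [MeasurableSpace X]
    [BorelSpace X] {α β : Measure X} [IsFiniteMeasure β] [α.InnerRegular] [β.InnerRegular]
    {μ : Measure (X × X)} (hμ : μ ∈ Coupling α β) {x : X} (hx : x ∈ msupport α)
    {U : Set X} (hU : IsOpen U) (hxU : x ∈ U) : ∃ z ∈ msupport μ, z.1 ∈ U := by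
  obtain ⟨K, hKU, hK, hK0⟩ := hU.measurableSet.exists_lt_isCompact (hx U hU hxU)
  obtain ⟨K', -, hK', hK'lt⟩ := (MeasurableSet.univ (α := X)).exists_isCompact_sdiff_lt
    (measure_ne_top β _) hK0.ne'
  have hpos : μ (K ×ˢ K') ≠ 0 := by
    intro h0
    refine hK'lt.not_ge ?_
    rw [← hμ.1, ← hμ.2, Measure.map_apply measurable_fst hK.measurableSet,
      Measure.map_apply measurable_snd (MeasurableSet.univ.diff hK'.measurableSet)]
    calc μ (Prod.fst ⁻¹' K)
        ≤ μ (K ×ˢ K' ∪ Prod.snd ⁻¹' (Set.univ \ K')) := by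
          refine measure_mono fun z hz => ?_
          by_cases h : z.2 ∈ K'
          · exact Or.inl ⟨hz, h⟩
          · exact Or.inr ⟨trivial, h⟩
      _ ≤ μ (K ×ˢ K') + μ (Prod.snd ⁻¹' (Set.univ \ K')) := measure_union_le _ _
      _ = μ (Prod.snd ⁻¹' (Set.univ \ K')) := by rw [h0, zero_add]
  obtain ⟨z, hz, hzμ⟩ := exists_mem_msupport_of_isCompact (hK.prod hK') hpos
  exact ⟨z, hzμ, hKU hz.1⟩

theorem ofReal_abs_abs_sub_abs_le [PseudoEMetricSpace X] {L : ℝ≥0} {φ : X → ℝ}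
    (hφ : LipschitzWith L φ) (x y : X) :
    ENNReal.ofReal |(|φ x| - |φ y|)| ≤ L * edist x y :=
  calc ENNReal.ofReal |(|φ x| - |φ y|)|
      ≤ ENNReal.ofReal |φ x - φ y| := ENNReal.ofReal_le_ofReal (abs_abs_sub_abs_le _ _)
    _ = edist (φ x) (φ y) := by rw [edist_dist, Real.dist_eq]
    _ ≤ L * edist x y := hφ x y

theorem ofReal_abs_le_add (a b : ℝ) :
    ENNReal.ofReal |a| ≤ ENNReal.ofReal |b| + ENNReal.ofReal |(|a| - |b|)| := by
  rw [← ENNReal.ofReal_add (abs_nonneg _) (abs_nonneg _)]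
  exact ENNReal.ofReal_le_ofReal (by linarith [le_abs_self (|a| - |b|)])

theorem pNormMeas_top_le_add_of_mem_Coupling [PseudoEMetricSpace X] [T2Space X]
    [MeasurableSpace X] [BorelSpace X] {L : ℝ≥0} {φ : X → ℝ} (hφ : LipschitzWith L φ)
    {α β : Measure X} [IsFiniteMeasure β] [α.InnerRegular] [β.InnerRegular]
    {μ : Measure (X × X)} (hμ : μ ∈ Coupling α β) :
    ⨆ x ∈ msupport α, ENNReal.ofReal |φ x| ≤
      (⨆ x ∈ msupport β, ENNReal.ofReal |φ x|) + L * ⨆ z ∈ msupport μ, edist z.1 z.2 := by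
  refine iSup₂_le fun x hx => ?_
  by_contra! hlt
  have hcont : Continuous fun y => ENNReal.ofReal |φ y| :=
    ENNReal.continuous_ofReal.comp hφ.continuous.abs
  obtain ⟨z, hz, hzU⟩ := exists_mem_msupport_coupling hμ hx (isOpen_Ioi.preimage hcont) hlt
  have hz2 : z.2 ∈ msupport β :=
    hμ.2 ▸ map_mem_msupport continuous_snd measurable_snd.aemeasurable hz
  refine (Set.mem_Ioi.1 hzU).not_ge ((ofReal_abs_le_add (φ z.1) (φ z.2)).trans ?_)
  refine add_le_add (le_iSup₂_of_le z.2 hz2 le_rfl)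
    ((ofReal_abs_abs_sub_abs_le hφ z.1 z.2).trans ?_)
  gcongr
  exact le_iSup₂_of_le z hz le_rfl

theorem lintegral_rpow_le_add_of_mem_Coupling [PseudoEMetricSpace X]
    [MeasurableSpace X] [BorelSpace X] {L : ℝ≥0} {φ : X → ℝ} (hφ : LipschitzWith L φ)
    {p : ℝ} (hp : 1 ≤ p) {α β : Measure X} {μ : Measure (X × X)} (hμ : μ ∈ Coupling α β) :
    (∫⁻ x, ENNReal.ofReal |φ x| ^ p ∂α) ^ (1 / p) ≤
      (∫⁻ x, ENNReal.ofReal |φ x| ^ p ∂β) ^ (1 / p) +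
        L * (∫⁻ z, edist z.1 z.2 ^ p ∂μ) ^ (1 / p) := by
  have hp0 : 0 < p := zero_lt_one.trans_le hp
  have hm : Measurable φ := hφ.continuous.measurable
  have hmp : Measurable fun x => ENNReal.ofReal |φ x| ^ p := by fun_prop
  have hm1 : Measurable fun z : X × X => φ z.1 := hm.comp measurable_fst
  have hm2 : Measurable fun z : X × X => φ z.2 := hm.comp measurable_snd
  have hf : Measurable fun z : X × X => ENNReal.ofReal |φ z.2| := by fun_prop
  have hg : Measurable fun z : X × X => ENNReal.ofReal |(|φ z.1| - |φ z.2|)| := by fun_prop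
  rw [← hμ.1, ← hμ.2, lintegral_map hmp measurable_fst, lintegral_map hmp measurable_snd]
  calc (∫⁻ z, ENNReal.ofReal |φ z.1| ^ p ∂μ) ^ (1 / p)
      ≤ (∫⁻ z, ((fun z : X × X => ENNReal.ofReal |φ z.2|) +
          fun z : X × X => ENNReal.ofReal |(|φ z.1| - |φ z.2|)|) z ^ p ∂μ) ^ (1 / p) := by
        gcongr with z
        exact ofReal_abs_le_add _ _
    _ ≤ _ := ENNReal.lintegral_Lp_add_le hf.aemeasurable hg.aemeasurable hp
    _ ≤ (∫⁻ z, ENNReal.ofReal |φ z.2| ^ p ∂μ) ^ (1 / p) +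
          (∫⁻ z, (L * edist z.1 z.2) ^ p ∂μ) ^ (1 / p) := by
        gcongr with z
        exact ofReal_abs_abs_sub_abs_le hφ _ _
    _ = _ := by
        simp_rw [ENNReal.mul_rpow_of_nonneg _ _ hp0.le]
        rw [lintegral_const_mul' _ _ (ENNReal.rpow_ne_top_of_nonneg hp0.le ENNReal.coe_ne_top),
          ENNReal.mul_rpow_of_nonneg _ _ (by positivity), ← ENNReal.rpow_mul,
          mul_one_div_cancel hp0.ne', ENNReal.rpow_one]

theorem le_add_mul_iInf_Coupling [MeasurableSpace X] {α β : Measure X}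
    [IsProbabilityMeasure α] [IsProbabilityMeasure β] {a b : ℝ≥0∞} {L : ℝ≥0}
    {c : Measure (X × X) → ℝ≥0∞} (h : ∀ μ ∈ Coupling α β, a ≤ b + L * c μ) :
    a ≤ b + L * ⨅ μ ∈ Coupling α β, c μ := by
  have : Nonempty (Coupling α β) := ⟨⟨_, prod_mem_Coupling α β⟩⟩
  rw [iInf_subtype', ENNReal.mul_iInf fun hL => absurd hL ENNReal.coe_ne_top, ENNReal.add_iInf]
  exact le_iInf fun μ => h μ.1 μ.2

theorem pNormMeas_le_add_mul_wDist [PseudoEMetricSpace X] [T2Space X] [MeasurableSpace X]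
    [BorelSpace X] {L : ℝ≥0} {φ : X → ℝ} (hφ : LipschitzWith L φ) {q : ℝ≥0∞} (hq : 1 ≤ q)
    (α β : Measure X) [IsProbabilityMeasure α] [IsProbabilityMeasure β]
    [α.InnerRegular] [β.InnerRegular] :
    pNormMeas q φ α ≤ pNormMeas q φ β + L * wDist q α β := by
  unfold pNormMeas wDist
  split_ifs with hq'
  · exact le_add_mul_iInf_Coupling fun μ hμ => pNormMeas_top_le_add_of_mem_Coupling hφ hμ
  · refine le_add_mul_iInf_Coupling fun μ hμ =>
      lintegral_rpow_le_add_of_mem_Coupling hφ ?_ hμ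
    simpa using ENNReal.toReal_mono hq' hq

/-- For an `L`-Lipschitz function `φ` on a bounded metric space `X`,
`q ∈ [1,∞]`, and Radon probability measures `α, β`:
`|(∫ |φ|^q dα)^{1/q} − (∫ |φ|^q dβ)^{1/q}| ≤ L · d_{W,q}(α,β)`. -/
theorem pNorm_diff_le_lipschitz_mul_wDist {X : Type*} [MetricSpace X] [MeasurableSpace X]
    [BorelSpace X] [BoundedSpace X]
    (L : ℝ≥0) (φ : X → ℝ) (hφ : LipschitzWith L φ) (q : ℝ≥0∞) (hq : 1 ≤ q)
    (α β : Measure X) [IsProbabilityMeasure α] [IsProbabilityMeasure β]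
    (hα : α.InnerRegular) (hβ : β.InnerRegular) :
    pNormMeas q φ α ≤ pNormMeas q φ β + (L : ℝ≥0∞) * wDist q α β ∧
    pNormMeas q φ β ≤ pNormMeas q φ α + (L : ℝ≥0∞) * wDist q α β := by
  refine ⟨pNormMeas_le_add_mul_wDist hφ hq α β,
    (pNormMeas_le_add_mul_wDist hφ hq β α).trans ?_⟩
  gcongr
  exact wDist_swap_le q α β

end Paper
end
end

section
/- Let X and Y be bounded metric spaces, let f : X → Y be any (not necessarily continuous) measurable map, let q, p ∈ [1,∞], and let α be a Radon probability measure on X. Then i_{q,p}^Y(f_♯ α) ≤ i_{q,p}^X(α) + dis(f), where f_♯ α is the pushforward measure. -/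
open MeasureTheory ENNReal NNReal

noncomputable section

namespace Paper

variable {X Y : Type*}

lemma isOpen_compl_msupport [TopologicalSpace X] [MeasurableSpace X] (α : Measure X) :
    IsOpen (msupport α)ᶜ := by
  rw [isOpen_iff_forall_mem_open]
  intro x hx
  simp only [msupport, Set.mem_compl_iff, Set.mem_ofPred_eq, not_forall, not_lt,
    nonpos_iff_eq_zero] at hx
  obtain ⟨U, hU, hxU, h0⟩ := hx
  exact ⟨U, fun y hy hy' => (hy' U hU hy).ne' h0, hU, hxU⟩

/-- An inner regular measure is concentrated on its support. -/
lemma ae_mem_msupport [TopologicalSpace X] [MeasurableSpace X] [OpensMeasurableSpace X]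
    {α : Measure X} (hα : α.InnerRegular) : ∀ᵐ x ∂α, x ∈ msupport α := by
  change α (msupport α)ᶜ = 0
  rw [(isOpen_compl_msupport α).measurableSet.measure_eq_iSup_isCompact]
  simp only [ENNReal.iSup_eq_zero]
  intro K hK hKc
  refine hKc.measure_zero_of_nhdsWithin fun x hx => ?_
  have hx' := hK hx
  simp only [msupport, Set.mem_compl_iff, Set.mem_ofPred_eq, not_forall, not_lt,
    nonpos_iff_eq_zero] at hx'
  obtain ⟨U, hU, hxU, h0⟩ := hx'
  exact ⟨U, mem_nhdsWithin_of_mem_nhds (hU.mem_nhds hxU), h0⟩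

/-- A point of the support of `α.map f` is a limit of images of points of the support of `α`. -/
lemma exists_mem_msupport_edist_lt [TopologicalSpace X] [MeasurableSpace X]
    [OpensMeasurableSpace X] [PseudoEMetricSpace Y] [MeasurableSpace Y] [OpensMeasurableSpace Y]
    {α : Measure X} (hα : α.InnerRegular) {f : X → Y} (hf : Measurable f) {y : Y}
    (hy : y ∈ msupport (α.map f)) {ε : ℝ≥0∞} (hε : 0 < ε) :
    ∃ x ∈ msupport α, edist y (f x) < ε := by
  have hopen : IsOpen {z : Y | edist y z < ε} :=
    isOpen_lt (continuous_const.edist continuous_id) continuous_const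
  have hpos := hy _ hopen (by simpa using hε)
  rw [Measure.map_apply hf hopen.measurableSet] at hpos
  by_contra! hcon
  have hsub : f ⁻¹' {z | edist y z < ε} ⊆ (msupport α)ᶜ :=
    fun x hx hx' => not_lt.2 (hcon x hx') hx
  exact hpos.ne' (measure_mono_null hsub (ae_mem_msupport hα))

lemma measurable_edist_const [PseudoEMetricSpace X] [MeasurableSpace X] [OpensMeasurableSpace X]
    (x : X) : Measurable fun a : X => edist a x :=
  (continuous_id.edist continuous_const).measurable

lemma ae_snd_eq_of_mem_coupling_dirac [MeasurableSpace X] [MeasurableSingletonClass X]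
    {α : Measure X} {x : X} {μ : Measure (X × X)} (hμ : μ ∈ Coupling α (Measure.dirac x)) :
    ∀ᵐ z ∂μ, z.2 = x := by
  have h : ∀ᵐ y ∂(μ.map Prod.snd), y = x := by
    rw [hμ.2, ae_dirac_eq]
    rfl
  exact ae_of_ae_map measurable_snd.aemeasurable h

/-- The `L^q` norm of the distance to `x` bounds the Wasserstein distance to `δ_x` from below. -/
lemma eLpNorm_edist_le_wDist [MetricSpace X] [MeasurableSpace X] [BorelSpace X]
    {α : Measure X} (hα : α.InnerRegular) {q : ℝ≥0∞} (hq : q ≠ 0) (x : X) :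
    eLpNorm (fun a => edist a x) q α ≤ wDist q α (Measure.dirac x) := by
  unfold wDist
  split_ifs with h
  · subst h
    refine le_iInf₂ fun μ hμ => ?_
    rw [eLpNorm_exponent_top]
    refine eLpNormEssSup_le_of_ae_enorm_bound ?_
    filter_upwards [ae_mem_msupport hα] with a ha
    refine le_iSup₂_of_le (a, x) (fun U hU hUa => ?_) (by simp)
    obtain ⟨V, W, hV, hW, haV, hxW, hVW⟩ := isOpen_prod_iff.1 hU a x hUa
    have hfst : α V = μ (Prod.fst ⁻¹' V) := by
      rw [← hμ.1, Measure.map_apply measurable_fst hV.measurableSet]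
    calc 0 < α V := ha V hV haV
      _ = μ (Prod.fst ⁻¹' V) := hfst
      _ ≤ μ U := by
        refine measure_mono_ae ?_
        filter_upwards [ae_snd_eq_of_mem_coupling_dirac hμ] with z hz hzV
        exact hVW ⟨hzV, hz ▸ hxW⟩
  · refine le_iInf₂ fun μ hμ => ?_
    rw [eLpNorm_eq_lintegral_rpow_enorm_toReal hq h]
    simp only [enorm_eq_self]
    refine le_of_eq ?_
    congr 1
    have hm : Measurable fun a : X => edist a x ^ q.toReal :=
      (measurable_edist_const x).pow_const _
    calc ∫⁻ a, edist a x ^ q.toReal ∂α = ∫⁻ z, edist z.1 x ^ q.toReal ∂μ := by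
          conv_lhs => rw [← hμ.1]
          rw [lintegral_map hm measurable_fst]
      _ = ∫⁻ z, edist z.1 z.2 ^ q.toReal ∂μ := by
          refine lintegral_congr_ae ?_
          filter_upwards [ae_snd_eq_of_mem_coupling_dirac hμ] with z hz
          rw [hz]

lemma map_prodMk_mem_coupling [MeasurableSpace X] (β : Measure X) [IsProbabilityMeasure β]
    (x : X) : β.map (fun b => (b, x)) ∈ Coupling β (Measure.dirac x) := by
  have h : Measurable fun b : X => (b, x) := measurable_id.prodMk measurable_const
  constructor
  · rw [Measure.map_map measurable_fst h]
    exact Measure.map_id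
  · rw [Measure.map_map measurable_snd h]
    change β.map (fun _ => x) = _
    rw [Measure.map_const, measure_univ, one_smul]

/-- The `L^q` norm of the distance to `x` bounds the Wasserstein distance to `δ_x` from above. -/
lemma wDist_le_eLpNorm_edist [MetricSpace X] [MeasurableSpace X] [BorelSpace X]
    (β : Measure X) [IsProbabilityMeasure β] {q : ℝ≥0∞} (hq : q ≠ 0) (x : X) :
    wDist q β (Measure.dirac x) ≤ eLpNorm (fun b => edist b x) q β := by
  have hmem := map_prodMk_mem_coupling β x
  unfold wDist
  split_ifs with h
  · subst h
    refine iInf₂_le_of_le _ hmem (iSup₂_le fun z hz => ?_)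
    by_contra! hlt
    have hopen : IsOpen {z : X × X | eLpNorm (fun b => edist b x) ∞ β < edist z.1 z.2} :=
      isOpen_lt continuous_const (continuous_fst.edist continuous_snd)
    refine (hz _ hopen hlt).ne' ?_
    have hae : ∀ᵐ b ∂β, edist b x ≤ eLpNorm (fun b => edist b x) ∞ β := by
      rw [eLpNorm_exponent_top]
      exact enorm_ae_le_eLpNormEssSup (fun b => edist b x) β
    have hae' : ∀ᵐ w ∂(β.map fun b => (b, x)),
        edist w.1 x ≤ eLpNorm (fun b => edist b x) ∞ β := by
      rw [← hmem.1] at hae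
      have := ae_of_ae_map measurable_fst.aemeasurable hae
      rwa [hmem.1] at this
    have hgood : ∀ᵐ w ∂(β.map fun b => (b, x)),
        ¬ eLpNorm (fun b => edist b x) ∞ β < edist w.1 w.2 := by
      filter_upwards [hae', ae_snd_eq_of_mem_coupling_dirac hmem] with w hw hw2
      rw [hw2]
      exact not_lt.2 hw
    simpa [ae_iff] using hgood
  · refine iInf₂_le_of_le _ hmem ?_
    rw [eLpNorm_eq_lintegral_rpow_enorm_toReal hq h]
    simp only [enorm_eq_self]
    gcongr
    exact lintegral_map_le _ _

lemma eLpNorm_add_const_le [MeasurableSpace X] (α : Measure X) [IsProbabilityMeasure α]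
    {g : X → ℝ≥0∞} (hg : Measurable g) (c : ℝ≥0∞) {q : ℝ≥0∞} (hq : 1 ≤ q) :
    eLpNorm (fun a => g a + c) q α ≤ eLpNorm g q α + c := by
  have hq0 : q ≠ 0 := (zero_lt_one.trans_le hq).ne'
  calc eLpNorm (fun a => g a + c) q α
      ≤ eLpNorm g q α + eLpNorm (fun _ => c) q α :=
        eLpNorm_add_le hg.aestronglyMeasurable aestronglyMeasurable_const hq
    _ = eLpNorm g q α + c := by
        rw [eLpNorm_const c hq0 (IsProbabilityMeasure.ne_zero α)]
        simp

lemma edist_map_le_add_distortion [PseudoEMetricSpace X] [PseudoEMetricSpace Y] (f : X → Y)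
    (x x' : X) : edist (f x) (f x') ≤ edist x x' + distortion f := by
  rw [← tsub_le_iff_left]
  exact le_iSup₂_of_le x x' (le_max_right _ _)

lemma eLpNorm_edist_le_add_edist [MetricSpace X] [MeasurableSpace X] [BorelSpace X]
    (α : Measure X) [IsProbabilityMeasure α] {q : ℝ≥0∞} (hq : 1 ≤ q) (x x' : X) :
    eLpNorm (fun a => edist a x) q α ≤ eLpNorm (fun a => edist a x') q α + edist x x' := by
  refine le_trans (eLpNorm_mono_enorm fun a => ?_)
    (eLpNorm_add_const_le α (measurable_edist_const x') (edist x x') hq)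
  simp only [enorm_eq_self]
  rw [edist_comm x x']
  exact edist_triangle _ _ _

lemma measurable_eLpNorm_edist [MetricSpace X] [MeasurableSpace X] [BorelSpace X]
    (α : Measure X) [IsProbabilityMeasure α] {q : ℝ≥0∞} (hq : 1 ≤ q) :
    Measurable fun x => eLpNorm (fun a => edist a x) q α := by
  refine Continuous.measurable (continuous_of_le_add_edist 1 one_ne_top fun x x' => ?_)
  rw [one_mul]
  exact eLpNorm_edist_le_add_edist α hq x x'

lemma eLpNorm_edist_map_le [MetricSpace X] [MeasurableSpace X] [BorelSpace X]
    [MetricSpace Y] [MeasurableSpace Y] [BorelSpace Y] {f : X → Y} (hf : Measurable f)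
    (α : Measure X) [IsProbabilityMeasure α] {q : ℝ≥0∞} (hq : 1 ≤ q) (x : X) :
    eLpNorm (fun b => edist b (f x)) q (α.map f) ≤
      eLpNorm (fun a => edist a x) q α + distortion f := by
  rw [eLpNorm_map_measure (measurable_edist_const _).aestronglyMeasurable hf.aemeasurable]
  refine le_trans (eLpNorm_mono_enorm fun a => ?_)
    (eLpNorm_add_const_le α (measurable_edist_const x) (distortion f) hq)
  exact edist_map_le_add_distortion f a x

/-- For bounded metric spaces `X, Y`, a measurable map `f : X → Y`,
`q, p ∈ [1,∞]`, and a Radon probability measure `α` on `X`: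
`i_{q,p}(f_♯ α) ≤ i_{q,p}(α) + dis(f)`. -/
theorem iInv_map_le {X Y : Type*} [MetricSpace X] [MeasurableSpace X] [BorelSpace X]
    [BoundedSpace X] [MetricSpace Y] [MeasurableSpace Y] [BorelSpace Y] [BoundedSpace Y]
    (f : X → Y) (hf : Measurable f) (q p : ℝ≥0∞) (hq : 1 ≤ q) (hp : 1 ≤ p)
    (α : Measure X) [IsProbabilityMeasure α] (hα : α.InnerRegular) :
    iInv q p (α.map f) ≤ iInv q p α + distortion f := by
  have hq0 : q ≠ 0 := (zero_lt_one.trans_le hq).ne'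
  have hp0 : p ≠ 0 := (zero_lt_one.trans_le hp).ne'
  have : IsProbabilityMeasure (α.map f) := Measure.isProbabilityMeasure_map hf.aemeasurable
  unfold iInv
  split_ifs with h
  · refine iSup₂_le fun y hy => ENNReal.le_of_forall_pos_le_add fun ε hε _ => ?_
    obtain ⟨x, hx, hyx⟩ := exists_mem_msupport_edist_lt hα hf hy (ENNReal.coe_pos.2 hε)
    calc wDist q (α.map f) (Measure.dirac y)
        ≤ eLpNorm (fun b => edist b y) q (α.map f) := wDist_le_eLpNorm_edist _ hq0 y
      _ ≤ eLpNorm (fun b => edist b (f x)) q (α.map f) + edist y (f x) :=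
          eLpNorm_edist_le_add_edist _ hq y (f x)
      _ ≤ eLpNorm (fun a => edist a x) q α + distortion f + ε := by
          gcongr
          exact eLpNorm_edist_map_le hf α hq x
      _ ≤ (⨆ x ∈ msupport α, wDist q α (Measure.dirac x)) + distortion f + ε := by
          gcongr
          exact le_iSup₂_of_le x hx (eLpNorm_edist_le_wDist hα hq0 x)
  · set g : X → ℝ≥0∞ := fun x => eLpNorm (fun a => edist a x) q α with hg
    calc (∫⁻ y, wDist q (α.map f) (Measure.dirac y) ^ p.toReal ∂(α.map f)) ^ (1 / p.toReal)
        ≤ (∫⁻ x, (g x + distortion f) ^ p.toReal ∂α) ^ (1 / p.toReal) := by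
          gcongr
          refine (lintegral_map_le _ _).trans (lintegral_mono fun x => ?_)
          dsimp only
          gcongr
          exact (wDist_le_eLpNorm_edist _ hq0 (f x)).trans (eLpNorm_edist_map_le hf α hq x)
      _ = eLpNorm (fun x => g x + distortion f) p α := by
          rw [eLpNorm_eq_lintegral_rpow_enorm_toReal hp0 h]
          simp only [enorm_eq_self]
      _ ≤ eLpNorm g p α + distortion f :=
          eLpNorm_add_const_le α (measurable_eLpNorm_edist α hq) _ hp
      _ ≤ (∫⁻ x, wDist q α (Measure.dirac x) ^ p.toReal ∂α) ^ (1 / p.toReal) + distortion f := by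
          rw [eLpNorm_eq_lintegral_rpow_enorm_toReal hp0 h]
          simp only [enorm_eq_self]
          gcongr with x
          exact eLpNorm_edist_le_wDist hα hq0 x

end Paper
end
end

section
/- Let X be a bounded metric space, let q, p ∈ [1,∞], and let α, β be Radon probability measures on X. Then |i_{q,p}^X(α) − i_{q,p}^X(β)| ≤ d_{W,q}(α,β) + d_{W,p}(α,β); in particular |i_{q,p}^X(α) − i_{q,p}^X(β)| ≤ 2·d_{W,∞}(α,β). -/
open MeasureTheory ENNReal NNReal

noncomputable section

namespace Paper

variable {X Y : Type*}

section Support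

variable {Z : Type*} [TopologicalSpace Z] [MeasurableSpace Z] {μ : Measure Z} {T : Set Z}

lemma msupport_mem_ae (hT : IsHereditarilyLindelof T) (hμ : T ∈ ae μ) : msupport μ ∈ ae μ := by
  have h_null : μ ((msupport μ)ᶜ ∩ T) = 0 := by
    have h_nhds : ∀ x ∈ (msupport μ)ᶜ ∩ T, ∃ U : Set Z, IsOpen U ∧ x ∈ U ∧ μ U = 0 := by
      rintro x ⟨hx, -⟩
      simpa [msupport] using hx
    choose! U hUo hxU hU using h_nhds
    obtain ⟨t, htc, htU, hcov⟩ := (hT.isLindelof_subset Set.inter_subset_right).elim_nhds_subcover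
      U fun x hx => (hUo x hx).mem_nhds (hxU x hx)
    exact measure_mono_null hcov ((measure_biUnion_null_iff htc).2 fun x hx => hU x (htU x hx))
  have h_ae : ((msupport μ)ᶜ ∩ T)ᶜ ∈ ae μ := compl_mem_ae_iff.2 h_null
  filter_upwards [h_ae, hμ] with x hx hxT
  by_contra h
  exact hx ⟨h, hxT⟩

lemma eLpNorm_top_eq_iSup_msupport (hT : IsHereditarilyLindelof T) (hμ : T ∈ ae μ)
    {f : Z → ℝ≥0∞} (hf : Continuous f) : eLpNorm f ∞ μ = ⨆ z ∈ msupport μ, f z := by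
  rw [eLpNorm_exponent_top]
  apply le_antisymm
  · refine essSup_le_of_ae_le _ ?_
    filter_upwards [msupport_mem_ae hT hμ] with z hz
    exact le_iSup₂ (f := fun z _ => f z) z hz
  · refine iSup₂_le fun z hz => le_of_not_gt fun hlt => ?_
    have h_pos := hz _ (isOpen_lt continuous_const hf) hlt
    have h_le : ∀ᵐ y ∂μ, f y ≤ eLpNormEssSup f μ := ae_le_eLpNormEssSup
    refine h_pos.ne' (measure_mono_null (fun y hy => ?_) (ae_iff.1 h_le))
    exact not_le.2 hy

end Support

section Coupling

variable [MeasurableSpace X] {α β : Measure X} {μ : Measure (X × X)}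

lemma measurePreserving_fst_of_mem_coupling (hμ : μ ∈ Coupling α β) :
    MeasurePreserving Prod.fst μ α := ⟨measurable_fst, hμ.1⟩

lemma measurePreserving_snd_of_mem_coupling (hμ : μ ∈ Coupling α β) :
    MeasurePreserving Prod.snd μ β := ⟨measurable_snd, hμ.2⟩

lemma isProbabilityMeasure_of_mem_coupling [IsProbabilityMeasure α] (hμ : μ ∈ Coupling α β) :
    IsProbabilityMeasure μ :=
  ⟨by rw [← Set.preimage_univ (f := Prod.fst), ← Measure.map_apply measurable_fst .univ, hμ.1,
    measure_univ]⟩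

end Coupling

section Concentrated

variable [MetricSpace X] [MeasurableSpace X] {α β : Measure X} {μ : Measure (X × X)}

/-- A measure is separably concentrated if it is carried by a closed separable set. -/
def SeparablyConcentrated [TopologicalSpace Y] [MeasurableSpace Y] (α : Measure Y) : Prop :=
  ∃ S : Set Y, IsClosed S ∧ TopologicalSpace.IsSeparable S ∧ S ∈ ae α

lemma isHereditarilyLindelof_of_isSeparable [TopologicalSpace Y]
    [TopologicalSpace.PseudoMetrizableSpace Y] {S : Set Y}
    (hS : TopologicalSpace.IsSeparable S) : IsHereditarilyLindelof S := by
  intro t ht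
  have := hS.secondCountableTopology
  have h := (HereditarilyLindelofSpace.isLindelof ((↑) ⁻¹' t : Set S)).image
    continuous_subtype_val
  rwa [Subtype.image_preimage_coe, Set.inter_eq_right.2 ht] at h

lemma exists_prod_mem_ae (hα : SeparablyConcentrated α) (hβ : SeparablyConcentrated β)
    (hμ : μ ∈ Coupling α β) :
    ∃ S : Set X, IsClosed S ∧ TopologicalSpace.IsSeparable S ∧ S ×ˢ S ∈ ae μ := by
  obtain ⟨A, hAc, hAs, hA⟩ := hα
  obtain ⟨B, hBc, hBs, hB⟩ := hβ
  refine ⟨A ∪ B, hAc.union hBc, hAs.union hBs, ?_⟩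
  filter_upwards [(measurePreserving_fst_of_mem_coupling hμ).quasiMeasurePreserving.ae hA,
    (measurePreserving_snd_of_mem_coupling hμ).quasiMeasurePreserving.ae hB] with z h₁ h₂
  exact ⟨Or.inl h₁, Or.inr h₂⟩

lemma wDist_eq_iInf_eLpNorm {q : ℝ≥0∞} (hq : q ≠ 0) (hα : SeparablyConcentrated α)
    (hβ : SeparablyConcentrated β) :
    wDist q α β = ⨅ μ ∈ Coupling α β, eLpNorm (fun z : X × X => edist z.1 z.2) q μ := by
  unfold wDist
  split_ifs with h
  · subst h
    refine biInf_congr fun μ hμ => ?_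
    obtain ⟨S, -, hSs, hS⟩ := exists_prod_mem_ae hα hβ hμ
    exact (eLpNorm_top_eq_iSup_msupport (isHereditarilyLindelof_of_isSeparable (hSs.prod hSs))
      hS (continuous_fst.edist continuous_snd)).symm
  · simp [eLpNorm_eq_lintegral_rpow_enorm_toReal hq h]

variable [BorelSpace X]

lemma separablyConcentrated_of_innerRegular [IsProbabilityMeasure α] (hα : α.InnerRegular) :
    SeparablyConcentrated α := by
  have h_compact : ∀ n : ℕ, ∃ K : Set X, IsCompact K ∧ α Kᶜ < (n : ℝ≥0∞)⁻¹ := by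
    intro n
    obtain ⟨K, -, hK, hlt⟩ := MeasurableSet.univ.exists_isCompact_sdiff_lt (μ := α)
      (measure_ne_top α _) (ε := (n : ℝ≥0∞)⁻¹) (by simp)
    exact ⟨K, hK, by rwa [Set.compl_eq_univ_sdiff]⟩
  choose K hK hlt using h_compact
  have hsub : ⋃ n, K n ⊆ closure (⋃ n, K n) := subset_closure
  refine ⟨closure (⋃ n, K n), isClosed_closure,
    (TopologicalSpace.isSeparable_iUnion.2 fun n => (hK n).isSeparable).closure, ?_⟩
  rw [mem_ae_iff, ← nonpos_iff_eq_zero]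
  refine ge_of_tendsto' ENNReal.tendsto_inv_nat_nhds_zero fun n => ?_
  exact (measure_mono (Set.compl_subset_compl.2
    ((Set.subset_iUnion K n).trans hsub))).trans (hlt n).le

lemma separablyConcentrated_dirac (x : X) : SeparablyConcentrated (Measure.dirac x) :=
  ⟨{x}, isClosed_singleton, (Set.finite_singleton x).isSeparable, by simp⟩

lemma aemeasurable_edist_of_mem_coupling (hα : SeparablyConcentrated α)
    (hβ : SeparablyConcentrated β) (hμ : μ ∈ Coupling α β) :
    AEMeasurable (fun z : X × X => edist z.1 z.2) μ := by
  obtain ⟨S, hSc, hSs, hS⟩ := exists_prod_mem_ae hα hβ hμ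
  have := hSs.secondCountableTopology
  rw [← Measure.restrict_eq_self_of_ae_mem hS]
  refine aemeasurable_restrict_of_measurable_subtype
    (hSc.measurableSet.prod hSc.measurableSet) ?_
  have h₁ : Measurable fun z : ↥(S ×ˢ S) => (⟨z.1.1, z.2.1⟩ : S) :=
    (measurable_fst.comp measurable_subtype_coe).subtype_mk
  have h₂ : Measurable fun z : ↥(S ×ˢ S) => (⟨z.1.2, z.2.2⟩ : S) :=
    (measurable_snd.comp measurable_subtype_coe).subtype_mk
  exact h₁.edist h₂

lemma wDist_dirac {q : ℝ≥0∞} (hq : q ≠ 0) (hα : SeparablyConcentrated α) (x : X)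
    [IsProbabilityMeasure α] :
    wDist q α (Measure.dirac x) = eLpNorm (fun y => edist y x) q α := by
  have h_coupling : ∀ μ ∈ Coupling α (Measure.dirac x),
      eLpNorm (fun z : X × X => edist z.1 z.2) q μ = eLpNorm (fun y => edist y x) q α := by
    intro μ hμ
    have h_snd : ∀ᵐ z ∂μ, z.2 = x := by
      have h_dirac : ∀ᵐ y ∂(Measure.dirac x), y = x := by simp [ae_dirac_eq]
      exact (measurePreserving_snd_of_mem_coupling hμ).quasiMeasurePreserving.ae h_dirac
    have h_meas : Measurable fun y : X => edist y x := measurable_edist_left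
    rw [← eLpNorm_comp_measurePreserving h_meas.aestronglyMeasurable
      (measurePreserving_fst_of_mem_coupling hμ)]
    refine eLpNorm_congr_ae ?_
    filter_upwards [h_snd] with z hz
    simp [hz]
  rw [wDist_eq_iInf_eLpNorm hq hα (separablyConcentrated_dirac x), biInf_congr h_coupling]
  refine biInf_const ⟨α.prod (Measure.dirac x), ?_, ?_⟩
  · simp
  · simp

lemma wDist_comm {q : ℝ≥0∞} (hq : q ≠ 0) (hα : SeparablyConcentrated α)
    (hβ : SeparablyConcentrated β) : wDist q α β = wDist q β α := by
  have h_le : ∀ {α β : Measure X}, SeparablyConcentrated α → SeparablyConcentrated β →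
      wDist q β α ≤ wDist q α β := by
    intro α β hα hβ
    rw [wDist_eq_iInf_eLpNorm hq hα hβ, wDist_eq_iInf_eLpNorm hq hβ hα]
    refine le_iInf₂ fun μ hμ => ?_
    have h_swap : μ.map Prod.swap ∈ Coupling β α := by
      constructor
      · rw [Measure.map_map measurable_fst measurable_swap]
        exact hμ.2
      · rw [Measure.map_map measurable_snd measurable_swap]
        exact hμ.1
    refine (iInf₂_le _ h_swap).trans_eq ?_
    rw [eLpNorm_map_measure
      (aemeasurable_edist_of_mem_coupling hβ hα h_swap).aestronglyMeasurable
      measurable_swap.aemeasurable]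
    simp [Function.comp_def, edist_comm]
  exact le_antisymm (h_le hβ hα) (h_le hα hβ)

lemma wDist_le_wDist_top {q : ℝ≥0∞} (hq : q ≠ 0) [IsProbabilityMeasure α]
    (hα : SeparablyConcentrated α) (hβ : SeparablyConcentrated β) :
    wDist q α β ≤ wDist ∞ α β := by
  rw [wDist_eq_iInf_eLpNorm hq hα hβ, wDist_eq_iInf_eLpNorm top_ne_zero hα hβ]
  refine iInf₂_mono fun μ hμ => ?_
  have := isProbabilityMeasure_of_mem_coupling hμ
  exact eLpNorm_le_eLpNorm_of_exponent_le le_top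
    (aemeasurable_edist_of_mem_coupling hα hβ hμ).aestronglyMeasurable

lemma wDist_dirac_le_add_wDist {q : ℝ≥0∞} (hq : 1 ≤ q) [IsProbabilityMeasure α]
    [IsProbabilityMeasure β] (hα : SeparablyConcentrated α) (hβ : SeparablyConcentrated β)
    (x : X) :
    wDist q α (Measure.dirac x) ≤ wDist q β (Measure.dirac x) + wDist q α β := by
  have hq₀ : q ≠ 0 := (zero_lt_one.trans_le hq).ne'
  rw [wDist_dirac hq₀ hα, wDist_dirac hq₀ hβ, wDist_eq_iInf_eLpNorm hq₀ hα hβ]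
  simp only [ENNReal.add_iInf]
  refine le_iInf₂ fun μ hμ => ?_
  have h_meas : Measurable fun y : X => edist y x := measurable_edist_left
  rw [← eLpNorm_comp_measurePreserving h_meas.aestronglyMeasurable
      (measurePreserving_fst_of_mem_coupling hμ),
    ← eLpNorm_comp_measurePreserving h_meas.aestronglyMeasurable
      (measurePreserving_snd_of_mem_coupling hμ)]
  refine le_trans (eLpNorm_mono_enorm fun z => ?_)
    (eLpNorm_add_le (h_meas.comp measurable_snd).aestronglyMeasurable
      (aemeasurable_edist_of_mem_coupling hα hβ hμ).aestronglyMeasurable hq)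
  simpa [add_comm] using edist_triangle z.1 z.2 x

lemma wDist_dirac_le_add_edist {q : ℝ≥0∞} (hq : 1 ≤ q) [IsProbabilityMeasure α]
    (hα : SeparablyConcentrated α) (x y : X) :
    wDist q α (Measure.dirac x) ≤ wDist q α (Measure.dirac y) + edist x y := by
  have hq₀ : q ≠ 0 := (zero_lt_one.trans_le hq).ne'
  rw [wDist_dirac hq₀ hα, wDist_dirac hq₀ hα]
  have h_const : eLpNorm (fun _ : X => edist x y) q α = edist x y := by
    rw [eLpNorm_const _ hq₀ (NeZero.ne α)]
    simp
  rw [← h_const]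
  refine le_trans (eLpNorm_mono_enorm fun z => ?_)
    (eLpNorm_add_le (measurable_edist_left (x := y)).aestronglyMeasurable
      aestronglyMeasurable_const hq)
  simpa [edist_comm] using edist_triangle z y x

lemma continuous_wDist_dirac {q : ℝ≥0∞} (hq : 1 ≤ q) [IsProbabilityMeasure α]
    (hα : SeparablyConcentrated α) : Continuous fun x => wDist q α (Measure.dirac x) :=
  continuous_of_le_add_edist 1 one_ne_top fun x y => by
    simpa using wDist_dirac_le_add_edist hq hα x y

lemma iInv_eq_eLpNorm {q p : ℝ≥0∞} (hq : 1 ≤ q) (hp : p ≠ 0) [IsProbabilityMeasure α]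
    (hα : SeparablyConcentrated α) :
    iInv q p α = eLpNorm (fun x => wDist q α (Measure.dirac x)) p α := by
  unfold iInv
  split_ifs with h
  · subst h
    have h_cont := continuous_wDist_dirac hq hα
    obtain ⟨S, -, hSs, hS⟩ := hα
    exact (eLpNorm_top_eq_iSup_msupport (isHereditarilyLindelof_of_isSeparable hSs) hS
      h_cont).symm
  · simp [eLpNorm_eq_lintegral_rpow_enorm_toReal hp h]

lemma iInv_le_add_wDist {q p : ℝ≥0∞} (hq : 1 ≤ q) (hp : 1 ≤ p) [IsProbabilityMeasure α]
    [IsProbabilityMeasure β] (hα : SeparablyConcentrated α) (hβ : SeparablyConcentrated β) :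
    iInv q p α ≤ iInv q p β + (wDist q α β + wDist p α β) := by
  have hp₀ : p ≠ 0 := (zero_lt_one.trans_le hp).ne'
  rw [iInv_eq_eLpNorm hq hp₀ hα, iInv_eq_eLpNorm hq hp₀ hβ, wDist_eq_iInf_eLpNorm hp₀ hα hβ]
  simp only [ENNReal.add_iInf]
  refine le_iInf₂ fun μ hμ => ?_
  have := isProbabilityMeasure_of_mem_coupling hμ
  have h_measα := (continuous_wDist_dirac hq hα).measurable
  have h_measβ := (continuous_wDist_dirac hq hβ).measurable
  have h_edist := (aemeasurable_edist_of_mem_coupling hα hβ hμ).aestronglyMeasurable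
  rw [← eLpNorm_comp_measurePreserving h_measα.aestronglyMeasurable
      (measurePreserving_fst_of_mem_coupling hμ),
    ← eLpNorm_comp_measurePreserving h_measβ.aestronglyMeasurable
      (measurePreserving_snd_of_mem_coupling hμ)]
  have h_const : eLpNorm (fun _ : X × X => wDist q α β) p μ = wDist q α β := by
    rw [eLpNorm_const _ hp₀ (NeZero.ne μ)]
    simp
  rw [← h_const]
  refine le_trans (eLpNorm_mono_enorm fun z => ?_)
    ((eLpNorm_add_le (h_measβ.comp measurable_snd).aestronglyMeasurable
      (aestronglyMeasurable_const.add h_edist) hp).trans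
      (add_le_add_right (eLpNorm_add_le aestronglyMeasurable_const h_edist hp) _))
  calc wDist q α (Measure.dirac z.1)
      ≤ wDist q β (Measure.dirac z.1) + wDist q α β := wDist_dirac_le_add_wDist hq hα hβ z.1
    _ ≤ wDist q β (Measure.dirac z.2) + edist z.1 z.2 + wDist q α β := by
      gcongr
      exact wDist_dirac_le_add_edist hq hβ z.1 z.2
    _ = wDist q β (Measure.dirac z.2) + (wDist q α β + edist z.1 z.2) := by ring

end Concentrated

/-- For a bounded metric space `X`, `q, p ∈ [1,∞]`, and Radon probability
measures `α, β` on `X`: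
`|i_{q,p}(α) − i_{q,p}(β)| ≤ d_{W,q}(α,β) + d_{W,p}(α,β)`, and in particular
`|i_{q,p}(α) − i_{q,p}(β)| ≤ 2 · d_{W,∞}(α,β)`  (each absolute-value inequality is expressed
as the corresponding pair of one-sided inequalities in `ℝ≥0∞`). -/
theorem iInv_stability {X : Type*} [MetricSpace X] [MeasurableSpace X] [BorelSpace X]
    [BoundedSpace X] (q p : ℝ≥0∞) (hq : 1 ≤ q) (hp : 1 ≤ p)
    (α β : Measure X) [IsProbabilityMeasure α] [IsProbabilityMeasure β]
    (hα : α.InnerRegular) (hβ : β.InnerRegular) :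
    (iInv q p α ≤ iInv q p β + (wDist q α β + wDist p α β) ∧
     iInv q p β ≤ iInv q p α + (wDist q α β + wDist p α β)) ∧
    (iInv q p α ≤ iInv q p β + 2 * wDist ∞ α β ∧
     iInv q p β ≤ iInv q p α + 2 * wDist ∞ α β) := by
  have hα' := separablyConcentrated_of_innerRegular hα
  have hβ' := separablyConcentrated_of_innerRegular hβ
  have hq₀ : q ≠ 0 := (zero_lt_one.trans_le hq).ne'
  have hp₀ : p ≠ 0 := (zero_lt_one.trans_le hp).ne'
  have hle : iInv q p α ≤ iInv q p β + (wDist q α β + wDist p α β) :=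
    iInv_le_add_wDist hq hp hα' hβ'
  have hge : iInv q p β ≤ iInv q p α + (wDist q α β + wDist p α β) := by
    rw [wDist_comm hq₀ hα' hβ', wDist_comm hp₀ hα' hβ']
    exact iInv_le_add_wDist hq hp hβ' hα'
  have htop : wDist q α β + wDist p α β ≤ 2 * wDist ∞ α β := by
    rw [two_mul]
    exact add_le_add (wDist_le_wDist_top hq₀ hα' hβ') (wDist_le_wDist_top hp₀ hα' hβ')
  exact ⟨⟨hle, hge⟩, hle.trans (by gcongr), hge.trans (by gcongr)⟩

end Paper
end
end

section
/- Let X and Y be bounded metric spaces, let f : X → Y be any measurable map, let p ∈ [1,∞], and let α be a Radon probability measure on X. Then rad_p(f_♯ α) ≤ rad_p(α) + dis(f), where f_♯ α is the pushforward measure. -/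
open MeasureTheory ENNReal NNReal

noncomputable section

namespace Paper

variable {X Y : Type*}

/-- A set of positive measure for an inner regular measure meets the support. -/
lemma exists_mem_msupport_of_measure_pos [TopologicalSpace X] [MeasurableSpace X]
    {α : Measure X} [α.InnerRegular] {s : Set X} (hs : MeasurableSet s) (hpos : 0 < α s) :
    ∃ a ∈ s, a ∈ msupport α := by
  obtain ⟨K, hKs, hK, hKpos⟩ := hs.exists_lt_isCompact hpos
  by_contra! h
  refine hKpos.ne' (hK.measure_zero_of_nhdsWithin fun a ha => ?_)
  have ha' : ¬ ∀ U : Set X, IsOpen U → a ∈ U → 0 < α U := h a (hKs ha)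
  push Not at ha'
  obtain ⟨U, hU, haU, hU0⟩ := ha'
  exact ⟨U, mem_nhdsWithin_of_mem_nhds (hU.mem_nhds haU), nonpos_iff_eq_zero.1 hU0⟩

/-- For bounded metric spaces `X, Y`, a measurable map `f : X → Y`,
`p ∈ [1,∞]`, and a Radon probability measure `α` on `X`:
`rad_p(f_♯ α) ≤ rad_p(α) + dis(f)`. -/
theorem pRad_map_le {X Y : Type*} [MetricSpace X] [MeasurableSpace X] [BorelSpace X]
    [BoundedSpace X] [MetricSpace Y] [MeasurableSpace Y] [BorelSpace Y] [BoundedSpace Y]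
    (f : X → Y) (hf : Measurable f) (p : ℝ≥0∞) (hp : 1 ≤ p)
    (α : Measure X) [IsProbabilityMeasure α] (hα : α.InnerRegular) :
    pRad p (α.map f) ≤ pRad p α + distortion f := by
  by_cases hp' : p = ∞
  · simp only [pRad, if_pos hp']
    rw [ENNReal.iInf_add]
    refine le_iInf fun x => iInf_le_of_le (f x) (iSup₂_le fun y hy => ?_)
    refine _root_.le_of_forall_pos_le_add fun ε hε => ?_
    have hball : 0 < α (f ⁻¹' Metric.eball y ε) := by
      rw [← Measure.map_apply hf Metric.isOpen_eball.measurableSet]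
      exact hy _ Metric.isOpen_eball (Metric.mem_eball_self hε)
    obtain ⟨a, hay, ha⟩ :=
      exists_mem_msupport_of_measure_pos (hf Metric.isOpen_eball.measurableSet) hball
    calc edist (f x) y ≤ edist (f x) (f a) + edist (f a) y := edist_triangle _ _ _
      _ ≤ (edist x a + distortion f) + ε :=
        add_le_add (edist_map_le_add_distortion f x a) (le_of_lt hay)
      _ ≤ ((⨆ a ∈ msupport α, edist x a) + distortion f) + ε := by
        gcongr
        exact le_iSup₂ (f := fun a (_ : a ∈ msupport α) => edist x a) a ha
  · simp only [pRad, if_neg hp']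
    rw [ENNReal.iInf_add]
    refine le_iInf fun x => iInf_le_of_le (f x) ?_
    have hp1 : 1 ≤ p.toReal := by simpa using ENNReal.toReal_mono hp' hp
    have hp0 : 0 < p.toReal := by linarith
    rw [lintegral_map (by fun_prop) hf]
    calc (∫⁻ a, edist (f x) (f a) ^ p.toReal ∂α) ^ (1 / p.toReal)
        ≤ (∫⁻ a, (edist x a + distortion f) ^ p.toReal ∂α) ^ (1 / p.toReal) := by
          gcongr with a
          exact edist_map_le_add_distortion f x a
      _ ≤ (∫⁻ a, edist x a ^ p.toReal ∂α) ^ (1 / p.toReal)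
          + (∫⁻ _, distortion f ^ p.toReal ∂α) ^ (1 / p.toReal) :=
          ENNReal.lintegral_Lp_add_le (f := fun a => edist x a) (g := fun _ => distortion f)
            (by fun_prop) (by fun_prop) hp1
      _ = _ := by
          rw [lintegral_const, measure_univ, mul_one, one_div, ENNReal.rpow_rpow_inv hp0.ne']

end Paper
end
end

section
/- Let X be a bounded subset of ℝ^n with reach τ > 0, and let α be a Radon probability measure supported on X whose Euclidean mean m(α) lies in the open τ-neighborhood U_τ(X) of X. Let φ(α) = π(m(α)) ∈ X, where π is the nearest-point projection onto X. Then along the linear interpolation α_t = (1−t)·α + t·δ_{φ(α)} (t ∈ [0,1]), both diam_2 and rad_2 attain their maximum at t = 0; that is, diam_2(α_t) ≤ diam_2(α) and rad_2(α_t) ≤ rad_2(α) for all t ∈ [0,1]. -/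
open MeasureTheory ENNReal NNReal

noncomputable section

namespace Paper

variable {X Y : Type*}

section SecondMoment

variable {E : Type*} [NormedAddCommGroup E]

theorem ae_mem_of_msupport_subset [HereditarilyLindelofSpace E] [MeasurableSpace E]
    {α : Measure E} {s : Set E} (h : msupport α ⊆ s) : ∀ᵐ x ∂α, x ∈ s := by
  filter_upwards [Measure.support_mem_ae (μ := α)] with x hx
  refine h fun U hU hxU ↦ ?_
  rw [Measure.support_eq_forall_isOpen] at hx
  exact hx U hxU hU

theorem edist_sq_eq_ofReal (x y : E) : edist x y ^ 2 = ENNReal.ofReal (‖y - x‖ ^ 2) := by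
  rw [edist_comm, edist_dist, dist_eq_norm, ENNReal.ofReal_pow (norm_nonneg _)]

variable [InnerProductSpace ℝ E] [CompleteSpace E] [MeasurableSpace E]

/-- The second moment about a point is the variance plus the squared distance to the mean. -/
theorem lintegral_edist_sq_eq_add {α : Measure E} [IsProbabilityMeasure α]
    (hα : MemLp id 2 α) (x : E) :
    ∫⁻ y, edist x y ^ 2 ∂α =
      ∫⁻ y, edist (∫ y, y ∂α) y ^ 2 ∂α + edist x (∫ y, y ∂α) ^ 2 := by
  set m := ∫ y, y ∂α with hm
  have hint : Integrable (fun y : E ↦ y) α := hα.integrable (by norm_num)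
  have hsub (c : E) : Integrable (fun y : E ↦ y - c) α := hint.sub (integrable_const c)
  have hsq (c : E) : Integrable (fun y : E ↦ ‖y - c‖ ^ 2) α :=
    (hα.sub (memLp_const c)).integrable_norm_pow (by norm_num)
  have hmoment (c : E) : ∫⁻ y, edist c y ^ 2 ∂α = ENNReal.ofReal (∫ y, ‖y - c‖ ^ 2 ∂α) := by
    simp_rw [edist_sq_eq_ofReal]
    exact (ofReal_integral_eq_lintegral_ofReal (hsq c) (ae_of_all _ fun _ ↦ by positivity)).symm
  have hcenter : ∫ y, inner ℝ (m - x) (y - m) ∂α = 0 := by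
    rw [integral_inner (hsub m), integral_sub hint (integrable_const m)]
    simp [← hm]
  rw [hmoment, hmoment, edist_sq_eq_ofReal, ← ENNReal.ofReal_add (by positivity) (by positivity)]
  congr 1
  have hexpand (y : E) : ‖y - x‖ ^ 2 =
      ‖y - m‖ ^ 2 + (2 * inner ℝ (m - x) (y - m) + ‖m - x‖ ^ 2) := by
    rw [← sub_add_sub_cancel y m x, norm_add_sq_real, real_inner_comm]
    ring
  have hinner : Integrable (fun y : E ↦ 2 * inner ℝ (m - x) (y - m)) α :=
    ((hsub m).const_inner (m - x)).const_mul 2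
  have hrest : Integrable (fun y : E ↦ 2 * inner ℝ (m - x) (y - m) + ‖m - x‖ ^ 2) α :=
    hinner.add (integrable_const _)
  rw [integral_congr_ae (ae_of_all _ hexpand), integral_add (hsq m) hrest,
    integral_add hinner (integrable_const _), integral_const_mul, hcenter]
  simp

end SecondMoment

/-- Let `X ⊆ ℝ^n` be bounded with reach `τ > 0`, and let `α` be a Radon
probability measure supported on `X` whose Euclidean mean `m(α) = ∫ y dα` lies in the open
`τ`-neighborhood of `X`.  If `z₀` is the nearest-point projection `π(m(α))` of `m(α)` onto
`X` (i.e. `z₀ ∈ X` realizes the distance from `m(α)` to `X`), then along the linear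
interpolation `α_t = (1−t)·α + t·δ_{z₀}` both `diam_2` and `rad_2` attain their maximum at
`t = 0`. -/
theorem interp_toward_projection_decreases {n : ℕ}
    (X : Set (EuclideanSpace ℝ (Fin n))) (hXbdd : Bornology.IsBounded X)
    (τ : ℝ) (hτ : 0 < τ) (hreach : reach X = ENNReal.ofReal τ)
    (α : Measure (EuclideanSpace ℝ (Fin n))) [IsProbabilityMeasure α]
    (hα : α.InnerRegular) (hsupp : msupport α ⊆ X)
    (hmean : ∃ x ∈ X, dist (∫ y, y ∂α) x < τ)
    (z₀ : EuclideanSpace ℝ (Fin n)) (hz₀X : z₀ ∈ X)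
    (hz₀ : dist (∫ y, y ∂α) z₀ = Metric.infDist (∫ y, y ∂α) X)
    (t : ℝ) (ht0 : 0 ≤ t) (ht1 : t ≤ 1) :
    pDiam 2 (ENNReal.ofReal (1 - t) • α + ENNReal.ofReal t • Measure.dirac z₀)
        ≤ pDiam 2 α ∧
    pRadIn 2 X (ENNReal.ofReal (1 - t) • α + ENNReal.ofReal t • Measure.dirac z₀)
        ≤ pRadIn 2 X α := by
  set m := ∫ y, y ∂α
  have hmem := ae_mem_of_msupport_subset hsupp
  obtain ⟨C, hC⟩ := hXbdd.exists_norm_le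
  have hLp : MemLp id 2 α :=
    MemLp.of_bound measurable_id.aestronglyMeasurable C (hmem.mono fun y hy ↦ hC y hy)
  set W := ∫⁻ y, edist m y ^ 2 ∂α
  have hmoment (x) : ∫⁻ y, edist x y ^ 2 ∂α = W + edist x m ^ 2 :=
    lintegral_edist_sq_eq_add hLp x
  have hnear : ∀ x ∈ X, edist z₀ m ^ 2 ≤ edist x m ^ 2 := by
    intro x hx
    rw [edist_dist, edist_dist, dist_comm z₀, hz₀, dist_comm x]
    gcongr
    exact Metric.infDist_le_dist_of_mem hx
  have hvar : edist z₀ m ^ 2 ≤ W := by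
    calc edist z₀ m ^ 2 = ∫⁻ _, edist z₀ m ^ 2 ∂α := by simp
      _ ≤ W := lintegral_mono_ae <| hmem.mono fun y hy ↦ by
        rw [edist_comm m y]
        exact hnear y hy
  set s := ENNReal.ofReal (1 - t)
  set r := ENNReal.ofReal t
  have hsr : s + r = 1 := by
    rw [← ENNReal.ofReal_add (by linarith) ht0]
    norm_num
  have hs1 : s ≤ 1 := hsr ▸ le_self_add
  have hmix (x) : ∫⁻ y, edist x y ^ 2 ∂(s • α + r • Measure.dirac z₀) =
      s * (W + edist x m ^ 2) + r * edist x z₀ ^ 2 := by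
    rw [lintegral_add_measure, lintegral_smul_measure, lintegral_smul_measure, hmoment,
      lintegral_dirac]
    rfl
  constructor
  · simp only [pDiam, ENNReal.ofNat_ne_top, if_false, ENNReal.toReal_ofNat, ENNReal.rpow_ofNat]
    refine ENNReal.rpow_le_rpow ?_ (by norm_num)
    simp_rw [hmix, hmoment]
    have hmeas (c : EuclideanSpace ℝ (Fin n)) : Measurable fun x ↦ edist x c ^ 2 := by fun_prop
    have hflip (c) : ∫⁻ x, edist x c ^ 2 ∂α = W + edist c m ^ 2 := by
      simp_rw [edist_comm _ c, hmoment]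
    have hdiam : ∫⁻ x, (W + edist x m ^ 2) ∂α = W + W := by
      rw [lintegral_add_right _ (hmeas m), hflip]
      simp
    have hdiam_mix : ∫⁻ x, (s * (W + edist x m ^ 2) + r * edist x z₀ ^ 2) ∂α =
        s * (W + W) + r * (W + edist z₀ m ^ 2) := by
      rw [lintegral_add_right _ ((hmeas z₀).const_mul r),
        lintegral_const_mul _ ((hmeas m).const_add W), lintegral_const_mul _ (hmeas z₀), hdiam,
        hflip]
    rw [lintegral_add_measure, lintegral_smul_measure, lintegral_smul_measure, hdiam_mix,
      lintegral_dirac, hdiam]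
    simp only [smul_eq_mul, edist_self]
    calc s * (s * (W + W) + r * (W + edist z₀ m ^ 2)) +
          r * (s * (W + edist z₀ m ^ 2) + r * 0 ^ 2)
        ≤ s * (s * (W + W) + r * (W + W)) + r * (1 * (W + W) + r * 0 ^ 2) := by gcongr
      _ = s * ((s + r) * (W + W)) + r * (W + W) := by ring
      _ = W + W := by rw [hsr, one_mul, ← add_mul, hsr, one_mul]
  · simp only [pRadIn, ENNReal.toReal_ofNat, ENNReal.rpow_ofNat, hmix, hmoment]
    refine le_iInf₂ fun x hx ↦ (iInf₂_le z₀ hz₀X).trans ?_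
    refine ENNReal.rpow_le_rpow ?_ (by norm_num)
    calc s * (W + edist z₀ m ^ 2) + r * edist z₀ z₀ ^ 2
        = s * (W + edist z₀ m ^ 2) := by simp
      _ ≤ 1 * (W + edist x m ^ 2) := by gcongr ?_ * (_ + ?_); exact hnear x hx
      _ = W + edist x m ^ 2 := one_mul _

end Paper
end
end

section
/- Let S^n = {x ∈ ℝ^{n+1} : ‖x‖ = 1} carry the Euclidean metric. Then for every Radon probability measure α on S^n, diam_2(α) = (2 − 2‖m(α)‖²)^{1/2} ≤ √2 and rad_2(α) = (2 − 2‖m(α)‖)^{1/2} ≤ √2, where m(α) = ∫_{S^n} x α(dx) is the Euclidean mean of α. -/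
open MeasureTheory ENNReal NNReal

noncomputable section

namespace Paper

variable {X Y : Type*}

lemma rpow_half_ofReal_eq_ofReal_sqrt {a : ℝ} (ha : 0 ≤ a) :
    ENNReal.ofReal a ^ (1 / (2 : ℝ≥0∞).toReal) = ENNReal.ofReal (Real.sqrt a) := by
  rw [ENNReal.ofReal_rpow_of_nonneg ha (by simp), ENNReal.toReal_ofNat, Real.sqrt_eq_rpow]

lemma integrable_coe_sphere {E : Type*} [NormedAddCommGroup E] [MeasurableSpace E]
    [BorelSpace E] [SecondCountableTopology E] (μ : Measure (Metric.sphere (0 : E) 1)) [IsFiniteMeasure μ] :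
    Integrable (fun y : Metric.sphere (0 : E) 1 => (y : E)) μ :=
  Integrable.of_bound continuous_subtype_val.aestronglyMeasurable 1
    (Filter.Eventually.of_forall fun y => (norm_eq_of_mem_sphere y).le)

section SphereMean

variable {E : Type*} [NormedAddCommGroup E] [InnerProductSpace ℝ E]

lemma edist_rpow_two_sphere (x y : Metric.sphere (0 : E) 1) :
    edist x y ^ (2 : ℝ≥0∞).toReal = ENNReal.ofReal (2 - 2 * inner ℝ (x : E) (y : E)) := by
  rw [edist_dist, ENNReal.ofReal_rpow_of_nonneg dist_nonneg (by simp), Subtype.dist_eq,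
    dist_eq_norm, ENNReal.toReal_ofNat, Real.rpow_two, norm_sub_sq_real, norm_eq_of_mem_sphere,
    norm_eq_of_mem_sphere]
  congr 1
  ring

lemma exists_inner_eq_norm_sphere [Nontrivial E] (v : E) :
    ∃ x : Metric.sphere (0 : E) 1, inner ℝ (x : E) v = ‖v‖ := by
  rcases eq_or_ne v 0 with rfl | hv
  · obtain ⟨x, hx⟩ := (NormedSpace.sphere_nonempty (x := (0 : E)) (r := 1)).2 zero_le_one
    exact ⟨⟨x, hx⟩, by simp⟩
  · have hv' : ‖v‖ ≠ 0 := norm_ne_zero_iff.2 hv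
    refine ⟨⟨‖v‖⁻¹ • v, by simp [norm_smul, hv']⟩, ?_⟩
    rw [real_inner_smul_left, real_inner_self_eq_norm_sq]
    field_simp

variable [MeasurableSpace E]

lemma inner_integral_sphere_le (μ : Measure (Metric.sphere (0 : E) 1))
    (x : Metric.sphere (0 : E) 1) : inner ℝ (x : E) (∫ y, (y : E) ∂μ) ≤ ‖∫ y, (y : E) ∂μ‖ := by
  simpa using real_inner_le_norm (x : E) (∫ y, (y : E) ∂μ)

lemma norm_integral_sphere_le_one (μ : Measure (Metric.sphere (0 : E) 1))
    [IsProbabilityMeasure μ] : ‖∫ y, (y : E) ∂μ‖ ≤ 1 := by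
  simpa using norm_integral_le_of_norm_le_const (μ := μ)
    (Filter.Eventually.of_forall fun y : Metric.sphere (0 : E) 1 => (norm_eq_of_mem_sphere y).le)

variable [BorelSpace E] [SecondCountableTopology E] [CompleteSpace E]

lemma lintegral_edist_rpow_two_sphere (μ : Measure (Metric.sphere (0 : E) 1))
    [IsProbabilityMeasure μ] (x : Metric.sphere (0 : E) 1) :
    ∫⁻ y, edist x y ^ (2 : ℝ≥0∞).toReal ∂μ
      = ENNReal.ofReal (2 - 2 * inner ℝ (x : E) (∫ y, (y : E) ∂μ)) := by
  have hint : Integrable (fun y : Metric.sphere (0 : E) 1 => inner ℝ (x : E) (y : E)) μ :=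
    (integrable_coe_sphere μ).const_inner _
  have hsub : Integrable (fun y : Metric.sphere (0 : E) 1 => 2 - 2 * inner ℝ (x : E) (y : E)) μ :=
    (integrable_const _).sub (hint.const_mul 2)
  simp_rw [edist_rpow_two_sphere]
  rw [← ofReal_integral_eq_lintegral_ofReal hsub,
    integral_sub (integrable_const _) (hint.const_mul 2), integral_const_mul,
    integral_inner (integrable_coe_sphere μ)]
  · simp
  · refine Filter.Eventually.of_forall fun y => ?_
    have := real_inner_le_norm (x : E) (y : E)
    simp only [norm_eq_of_mem_sphere, mul_one] at this
    simp only [Pi.zero_apply]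
    linarith

lemma pDiam_two_sphere (μ : Measure (Metric.sphere (0 : E) 1))
    [IsProbabilityMeasure μ] :
    pDiam 2 μ = ENNReal.ofReal (Real.sqrt (2 - 2 * ‖∫ y, (y : E) ∂μ‖ ^ 2)) := by
  have hint : Integrable
      (fun x : Metric.sphere (0 : E) 1 => inner ℝ (x : E) (∫ y, (y : E) ∂μ)) μ :=
    (integrable_coe_sphere μ).inner_const _
  have hsub : Integrable (fun y : Metric.sphere (0 : E) 1 => 2 - 2 * inner ℝ (y : E) (∫ z, (z : E) ∂μ)) μ :=
    (integrable_const _).sub (hint.const_mul 2)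
  have hle := norm_integral_sphere_le_one μ
  rw [pDiam, if_neg ENNReal.ofNat_ne_top]
  simp_rw [lintegral_edist_rpow_two_sphere μ]
  rw [← ofReal_integral_eq_lintegral_ofReal hsub,
    integral_sub (integrable_const _) (hint.const_mul 2), integral_const_mul]
  · simp_rw [real_inner_comm (∫ y, (y : E) ∂μ)]
    rw [integral_inner (integrable_coe_sphere μ), real_inner_self_eq_norm_sq,
      integral_const, probReal_univ, one_smul]
    exact rpow_half_ofReal_eq_ofReal_sqrt (by nlinarith [norm_nonneg (∫ y, (y : E) ∂μ)])
  · refine Filter.Eventually.of_forall fun x => ?_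
    have := inner_integral_sphere_le μ x
    simp only [Pi.zero_apply]
    linarith

lemma pRad_two_sphere [Nontrivial E] (μ : Measure (Metric.sphere (0 : E) 1))
    [IsProbabilityMeasure μ] :
    pRad 2 μ = ENNReal.ofReal (Real.sqrt (2 - 2 * ‖∫ y, (y : E) ∂μ‖)) := by
  have hle := norm_integral_sphere_le_one μ
  rw [pRad, if_neg ENNReal.ofNat_ne_top]
  simp_rw [lintegral_edist_rpow_two_sphere μ]
  rw [← rpow_half_ofReal_eq_ofReal_sqrt (by linarith)]
  apply le_antisymm
  · obtain ⟨x, hx⟩ := exists_inner_eq_norm_sphere (∫ y, (y : E) ∂μ)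
    exact (iInf_le _ x).trans_eq (by rw [hx])
  · refine le_iInf fun x => ENNReal.rpow_le_rpow (ENNReal.ofReal_le_ofReal ?_) (by simp)
    have := inner_integral_sphere_le μ x
    linarith

end SphereMean

/-- For every Radon probability measure `α` on the unit sphere
`S^n ⊆ ℝ^{n+1}` with the Euclidean metric:
`diam_2(α) = (2 − 2‖m(α)‖²)^{1/2} ≤ √2` and `rad_2(α) = (2 − 2‖m(α)‖)^{1/2} ≤ √2`,
where `m(α) = ∫ x dα` is the Euclidean mean of `α`. -/
theorem sphere_diam2_rad2 {n : ℕ}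
    (α : ProbabilityMeasure ↥(Metric.sphere (0 : EuclideanSpace ℝ (Fin (n + 1))) 1))
    (hα : α.toMeasure.InnerRegular) :
    pDiam 2 α.toMeasure
        = ENNReal.ofReal (Real.sqrt
            (2 - 2 * ‖∫ x, (x : EuclideanSpace ℝ (Fin (n + 1))) ∂α.toMeasure‖ ^ 2)) ∧
    pDiam 2 α.toMeasure ≤ ENNReal.ofReal (Real.sqrt 2) ∧
    pRad 2 α.toMeasure
        = ENNReal.ofReal (Real.sqrt
            (2 - 2 * ‖∫ x, (x : EuclideanSpace ℝ (Fin (n + 1))) ∂α.toMeasure‖)) ∧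
    pRad 2 α.toMeasure ≤ ENNReal.ofReal (Real.sqrt 2) := by
  rw [pDiam_two_sphere, pRad_two_sphere]
  refine ⟨rfl, ENNReal.ofReal_le_ofReal (Real.sqrt_le_sqrt ?_), rfl,
    ENNReal.ofReal_le_ofReal (Real.sqrt_le_sqrt ?_)⟩
  · exact sub_le_self _ (by positivity)
  · exact sub_le_self _ (by positivity)

end Paper
end
end
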